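/- Let N ≥ 2 and let S̃_N be Schur's double cover of the symmetric group, presented by generators z, t_1, …, t_{N−1} with relations z² = 1, t_i² = z, (t_i t_{i+1})³ = z, and (t_i t_j)² = z for |i − j| ≥ 2. Let a ≥ 1 and k ≥ 2 be integers with a + k − 2 ≤ N − 1, and set π_k = t_a t_{a+1} ⋯ t_{a+k−2}. Then π_k^k = 1 if k ≡ 0, 1, 6, or 7 (mod 8), and π_k^k = z if k ≡ 2, 3, 4, or 5 (mod 8). -/

import Mathlib

/-!
Schur's double cover `S̃_N` of the symmetric group, presented by generators
`z, t_1, …, t_{N-1}` and relations `z² = 1`, `t_i² = z`, `(t_i t_{i+1})³ = z`,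
`(t_i t_j)² = z` for `|i − j| ≥ 2`.

Generators are indexed by `Option (Fin (N-1))`: `none` is the central element `z`
and `some i` is `t_{i+1}` (so `some i` for `i = 0, …, N-2` are `t_1, …, t_{N-1}`).
-/

abbrev SchurGen (N : ℕ) := Option (Fin (N - 1))

namespace Schur

/-- The relator `z` as an element of the free group. -/
def zf (N : ℕ) : FreeGroup (SchurGen N) := FreeGroup.of none

/-- The generator `t_{i+1}` as an element of the free group. -/
def tf (N : ℕ) (i : Fin (N - 1)) : FreeGroup (SchurGen N) := FreeGroup.of (some i)

/-- The defining relators of Schur's double cover. -/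
def rels (N : ℕ) : Set (FreeGroup (SchurGen N)) :=
  { r | r = zf N ^ 2 ∨
        (∃ i, r = tf N i ^ 2 * (zf N)⁻¹) ∨
        (∃ i j : Fin (N - 1), (i : ℕ) + 1 = (j : ℕ) ∧
          r = (tf N i * tf N j) ^ 3 * (zf N)⁻¹) ∨
        (∃ i j : Fin (N - 1), ((i : ℕ) + 2 ≤ (j : ℕ) ∨ (j : ℕ) + 2 ≤ (i : ℕ)) ∧
          r = (tf N i * tf N j) ^ 2 * (zf N)⁻¹) }

/-- Schur's double cover `S̃_N` of the symmetric group `S_N`. -/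
abbrev Cover (N : ℕ) := PresentedGroup (rels N)

/-- The central element `z` of `S̃_N`. -/
def z (N : ℕ) : Cover N := PresentedGroup.of none

/-- The generator `t_{i+1}` of `S̃_N` (0-indexed). -/
def t (N : ℕ) (i : Fin (N - 1)) : Cover N := PresentedGroup.of (some i)

/-- The generator `t_i` of `S̃_N`, 1-indexed: meaningful for `1 ≤ i ≤ N-1`
(junk value `1` outside this range). -/
def T (N i : ℕ) : Cover N := if h : i - 1 < N - 1 then t N ⟨i - 1, h⟩ else 1

/-- The product `t_a t_{a+1} ⋯ t_{a+n-1}` (`n` consecutive generators, 1-indexed). -/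
def P (N a n : ℕ) : Cover N := ((List.range n).map fun j => T N (a + j)).prod

end Schur


namespace Schur

/-- Elements `u 0, …, u (M - 1)` of a group satisfying the relations of the generators of
Schur's double cover, with respect to a central involution `w`. -/
structure IsSpinBraid {G : Type*} [Group G] (w : G) (u : ℕ → G) (M : ℕ) : Prop where
  central : ∀ g, g * w = w * g
  sq_central : w ^ 2 = 1
  sq : ∀ i < M, u i * u i = w
  braid : ∀ i, i + 1 < M → u i * u (i + 1) * u i = u (i + 1) * u i * u (i + 1)
  anticomm : ∀ i j, i + 2 ≤ j → j < M → u i * u j = w * (u j * u i)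

/-- The ascending product `u 0 * u 1 * ⋯ * u (n - 1)`. -/
def ascProd {G : Type*} [Group G] (u : ℕ → G) (n : ℕ) : G := ((List.range n).map u).prod

/-- The descending product `u n * u (n - 1) * ⋯ * u (n + 1 - m)` of `m` factors. -/
def descProd {G : Type*} [Group G] (u : ℕ → G) (n m : ℕ) : G :=
  ((List.range m).map fun i => u (n - i)).prod

section Products

variable {G : Type*} [Group G] (u : ℕ → G)

@[simp]
lemma ascProd_zero : ascProd u 0 = 1 := by simp [ascProd]

lemma ascProd_succ (n : ℕ) : ascProd u (n + 1) = ascProd u n * u n :=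
  List.prod_range_succ _ _

@[simp]
lemma descProd_zero (n : ℕ) : descProd u n 0 = 1 := by simp [descProd]

lemma descProd_succ (n m : ℕ) : descProd u n (m + 1) = descProd u n m * u (n - m) :=
  List.prod_range_succ _ _

lemma descProd_succ' (n m : ℕ) : descProd u n (m + 1) = u n * descProd u (n - 1) m := by
  rw [descProd, List.prod_range_succ', descProd, Nat.sub_zero]
  simp only [Nat.sub_sub, Nat.add_comm 1, Nat.succ_eq_add_one]

end Products

namespace IsSpinBraid

variable {G : Type*} [Group G] {w : G} {u : ℕ → G} {M : ℕ}

lemma mul_pow_central (h : IsSpinBraid w u M) (g : G) (k : ℕ) : g * w ^ k = w ^ k * g :=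
  ((show Commute g w from h.central g).pow_right k).eq

lemma mul_pow_central_mul (h : IsSpinBraid w u M) (g g' : G) (k : ℕ) :
    g * (w ^ k * g') = w ^ k * (g * g') := by
  rw [← mul_assoc, h.mul_pow_central, mul_assoc]

lemma pow_eq_pow (h : IsSpinBraid w u M) {k l : ℕ} (hkl : k % 2 = l % 2) : w ^ k = w ^ l := by
  rw [pow_eq_pow_mod k h.sq_central, hkl, ← pow_eq_pow_mod l h.sq_central]

lemma ascProd_mul_of_lt (h : IsSpinBraid w u M) {i j : ℕ} (hij : i < j) (hj : j < M) :
    ascProd u i * u j = w ^ i * (u j * ascProd u i) := by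
  induction i with
  | zero => simp
  | succ i ih =>
    rw [ascProd_succ, mul_assoc, h.anticomm i j hij hj, ← pow_one w, h.mul_pow_central_mul,
      ← mul_assoc (ascProd u i), ih (by omega), pow_one, pow_succ']
    simp only [mul_assoc]

lemma ascProd_mul (h : IsSpinBraid w u M) {i n : ℕ} (hin : i + 2 ≤ n) (hn : n ≤ M) :
    ascProd u n * u i = w ^ n * (u (i + 1) * ascProd u n) := by
  induction n, hin using Nat.le_induction with
  | base =>
    have hb := h.braid i (by omega)
    have hc := h.ascProd_mul_of_lt (Nat.lt_succ_self i) (by omega)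
    rw [h.pow_eq_pow (show (i + 2) % 2 = i % 2 by omega), ascProd_succ, ascProd_succ]
    calc _ = ascProd u i * (u i * u (i + 1) * u i) := by simp only [mul_assoc]
      _ = ascProd u i * u (i + 1) * (u i * u (i + 1)) := by rw [hb]; simp only [mul_assoc]
      _ = _ := by rw [hc]; simp only [mul_assoc]
  | succ n hin ih =>
    have hc : u n * u i = w ^ 1 * (u i * u n) := by
      rw [h.anticomm i n hin (by omega), ← mul_assoc, pow_one, ← pow_two, h.sq_central, one_mul]
    rw [ascProd_succ, mul_assoc, hc, h.mul_pow_central_mul, ← mul_assoc (ascProd u n),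
      ih (by omega), pow_succ' w n, pow_one]
    simp only [mul_assoc]

lemma mul_ascProd (h : IsSpinBraid w u M) {i n : ℕ} (hin : i + 2 ≤ n) (hn : n ≤ M) :
    u (i + 1) * ascProd u n = w ^ n * (ascProd u n * u i) := by
  rw [h.ascProd_mul hin hn, ← mul_assoc, ← pow_add,
    h.pow_eq_pow (show (n + n) % 2 = 0 % 2 by omega), pow_zero, one_mul]

lemma descProd_mul_ascProd (h : IsSpinBraid w u M) {m n : ℕ} (hmn : m ≤ n) (hn : n < M) :
    descProd u n m * ascProd u (n + 1) =
      w ^ ((n + 1) * m) * (ascProd u (n + 1) * descProd u (n - 1) m) := by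
  induction m with
  | zero => simp
  | succ m ih =>
    have hs : n - m = n - 1 - m + 1 := by omega
    rw [descProd_succ, mul_assoc, hs, h.mul_ascProd (by omega) (by omega), h.mul_pow_central_mul,
      ← mul_assoc (descProd u n m), ih (by omega), descProd_succ, mul_add_one,
      Nat.add_comm _ (n + 1), pow_add w (n + 1)]
    simp only [mul_assoc]

lemma descProd_mul_ascProd_self (h : IsSpinBraid w u M) {n : ℕ} (hn : n < M) :
    descProd u n (n + 1) * ascProd u (n + 1) = w ^ (n + 1) := by
  induction n with
  | zero => simp [descProd_succ, ascProd_succ, h.sq 0 hn]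
  | succ n ih =>
    rw [descProd_succ', ascProd_succ, Nat.add_sub_cancel, mul_assoc,
      ← mul_assoc (descProd u n (n + 1)), ih (by omega), h.mul_pow_central_mul, h.sq _ hn,
      ← pow_succ]

lemma ascProd_pow_succ (h : IsSpinBraid w u M) {m n : ℕ} (hmn : m ≤ n) (hn : n < M) :
    ascProd u (n + 1) ^ (m + 1) = w ^ ((n + 1) * ∑ i ∈ Finset.range (m + 1), i) *
      (ascProd u n ^ (m + 1) * descProd u n (m + 1)) := by
  induction m with
  | zero => simp [descProd_succ, ascProd_succ]
  | succ m ih =>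
    rw [pow_succ, ih (by omega), mul_assoc, mul_assoc, h.descProd_mul_ascProd hmn hn,
      h.mul_pow_central_mul, ← mul_assoc (w ^ _), ← pow_add, ← mul_add,
      ← Finset.sum_range_succ, ascProd_succ, descProd_succ' u n (m + 1), pow_succ _ (m + 1)]
    simp only [mul_assoc]

lemma ascProd_pow (h : IsSpinBraid w u M) {n : ℕ} (hn : n < M) :
    ascProd u (n + 1) ^ (n + 2) =
      w ^ ((n + 1) * ∑ i ∈ Finset.range (n + 1), i + (n + 1)) * ascProd u n ^ (n + 1) := by
  rw [pow_succ, h.ascProd_pow_succ le_rfl hn, mul_assoc, mul_assoc,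
    h.descProd_mul_ascProd_self hn, h.mul_pow_central, ← mul_assoc, ← pow_add]

lemma ascProd_pow_eq (h : IsSpinBraid w u M) {n : ℕ} (hn : n ≤ M) :
    ascProd u n ^ (n + 1) = w ^ ((n + 3) / 4) := by
  induction n with
  | zero => simp
  | succ n ih =>
    rw [h.ascProd_pow (by omega), ih (by omega), ← pow_add]
    apply h.pow_eq_pow
    have hs := Finset.sum_range_id_mul_two (n + 1)
    rw [Nat.add_sub_cancel] at hs
    obtain ⟨q, r, hr, rfl⟩ : ∃ q r, r < 4 ∧ n = 4 * q + r :=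
      ⟨n / 4, n % 4, Nat.mod_lt _ (by norm_num), (Nat.div_add_mod n 4).symm⟩
    generalize ∑ i ∈ Finset.range (4 * q + r + 1), i = S at hs ⊢
    interval_cases r
    · have : S = 2 * (q * (4 * q + 1)) := by linarith
      rw [this, Nat.mul_left_comm]
      omega
    · have : (4 * q + 1 + 1) * S = 2 * ((2 * q + 1) * S) := by ring
      rw [this]
      omega
    · have : S = 2 * (4 * q * q + 5 * q + 1) + 1 := by linarith
      have : (4 * q + 2 + 1) * S = 2 * ((4 * q + 3) * (4 * q * q + 5 * q + 1)) + (4 * q + 3) := by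
        rw [this]; ring
      rw [this]
      omega
    · have : (4 * q + 3 + 1) * S = 2 * ((2 * q + 2) * S) := by ring
      rw [this]
      omega

end IsSpinBraid

section Relations

variable {G : Type*} [Group G] {w x y : G}

lemma mul_mul_mul_eq_one (hc : ∀ g, g * w = w * g) (hw : w ^ 2 = 1) (hx : x ^ 2 = w)
    (hy : y ^ 2 = w) : y * x * (x * y) = 1 := by
  rw [mul_assoc, ← mul_assoc x, ← pow_two, hx, ← hc, ← mul_assoc, ← pow_two, hy, ← pow_two, hw]

lemma braid_of_pow_three_eq (hc : ∀ g, g * w = w * g) (hw : w ^ 2 = 1) (hx : x ^ 2 = w)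
    (hy : y ^ 2 = w) (hxy : (x * y) ^ 3 = w) : x * y * x = y * x * y := by
  apply mul_right_cancel (b := y * x * y)
  calc x * y * x * (y * x * y) = (x * y) ^ 3 := by simp only [pow_three, mul_assoc]
    _ = y * (x * y * (y * x)) * y := by
      rw [hxy, mul_mul_mul_eq_one hc hw hy hx, mul_one, ← pow_two, hy]
    _ = _ := by simp only [mul_assoc]

lemma anticomm_of_sq_eq (hc : ∀ g, g * w = w * g) (hw : w ^ 2 = 1) (hx : x ^ 2 = w)
    (hy : y ^ 2 = w) (hxy : (x * y) ^ 2 = w) : x * y = w * (y * x) := by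
  apply mul_right_cancel (b := x * y)
  rw [← pow_two, hxy, mul_assoc, mul_mul_mul_eq_one hc hw hx hy, mul_one]

end Relations

section Cover

variable (N : ℕ)

lemma z_sq : z N ^ 2 = 1 :=
  PresentedGroup.one_of_mem (rels := rels N) (Or.inl rfl)

lemma t_sq (i : Fin (N - 1)) : t N i ^ 2 = z N :=
  mul_inv_eq_one.mp <| PresentedGroup.one_of_mem (rels := rels N) (Or.inr <| Or.inl ⟨i, rfl⟩)

lemma t_mul_t_pow_three (i j : Fin (N - 1)) (hij : (i : ℕ) + 1 = j) :
    (t N i * t N j) ^ 3 = z N :=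
  mul_inv_eq_one.mp <| PresentedGroup.one_of_mem (rels := rels N)
    (Or.inr <| Or.inr <| Or.inl ⟨i, j, hij, rfl⟩)

lemma t_mul_t_sq (i j : Fin (N - 1)) (hij : (i : ℕ) + 2 ≤ j) : (t N i * t N j) ^ 2 = z N :=
  mul_inv_eq_one.mp <| PresentedGroup.one_of_mem (rels := rels N)
    (Or.inr <| Or.inr <| Or.inr ⟨i, j, Or.inl hij, rfl⟩)

lemma mul_z (g : Cover N) : g * z N = z N * g := by
  induction g using PresentedGroup.induction_on with
  | _ g =>
  induction g using FreeGroup.induction_on with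
  | C1 => simp
  | of x =>
    cases x with
    | none => rfl
    | some i =>
      change t N i * z N = z N * t N i
      rw [← t_sq N i, ← pow_succ, ← pow_succ']
  | inv_of x ih =>
    rw [map_inv]
    exact (show Commute _ _ from ih).inv_left
  | mul x y hx hy =>
    rw [map_mul]
    exact (show Commute _ _ from hx).mul_left hy

lemma isSpinBraid_t {a M : ℕ} (ha : 1 ≤ a) (haM : a + M ≤ N) :
    IsSpinBraid (z N) (fun j => T N (a + j)) M := by
  have hT : ∀ i (hi : i < M), T N (a + i) = t N ⟨a + i - 1, by omega⟩ := fun i hi =>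
    dif_pos _
  refine ⟨mul_z N, z_sq N, fun i hi => ?_, fun i hi => ?_, fun i j hij hj => ?_⟩
  · simp only [hT i hi, ← pow_two, t_sq]
  · simp only [hT i (by omega), hT (i + 1) hi]
    have h3 := t_mul_t_pow_three N ⟨a + i - 1, by omega⟩ ⟨a + (i + 1) - 1, by omega⟩
      (by simp only; omega)
    exact braid_of_pow_three_eq (mul_z N) (z_sq N) (t_sq N _) (t_sq N _) h3
  · simp only [hT i (by omega), hT j hj]
    have h2 := t_mul_t_sq N ⟨a + i - 1, by omega⟩ ⟨a + j - 1, by omega⟩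
      (by simp only; omega)
    exact anticomm_of_sq_eq (mul_z N) (z_sq N) (t_sq N _) (t_sq N _) h2

end Cover

end Schur

open Schur in
/-- Corollary: for `π_k = t_a t_{a+1} ⋯ t_{a+k-2}` in Schur's double cover `S̃_N`,
`π_k^k = 1` if `k ≡ 0, 1, 6, 7 (mod 8)` and `π_k^k = z` if `k ≡ 2, 3, 4, 5 (mod 8)`. -/
theorem schur_power_of_cycle (N : ℕ) (hN : 2 ≤ N) (a k : ℕ) (ha : 1 ≤ a) (hk : 2 ≤ k)
    (hrange : a + k - 2 ≤ N - 1) :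
    P N a (k - 1) ^ k =
      if k % 8 = 0 ∨ k % 8 = 1 ∨ k % 8 = 6 ∨ k % 8 = 7 then 1 else z N := by
  obtain ⟨n, rfl⟩ : ∃ n, k = n + 1 := ⟨k - 1, by omega⟩
  have h := (isSpinBraid_t N ha (show a + n ≤ N by omega)).ascProd_pow_eq le_rfl
  rw [Nat.add_sub_cancel]
  refine Eq.trans h ?_
  rw [pow_eq_pow_mod _ (z_sq N)]
  split_ifs
  · rw [show (n + 3) / 4 % 2 = 0 by omega, pow_zero]
  · rw [show (n + 3) / 4 % 2 = 1 by omega, pow_one]
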